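/- arXiv:1006.2185 — 3 statements merged into one kernel-verified Lean document; each statement's English description precedes it below -/
import Mathlib

section
/- Let d, d₁ be positive integers and κ ∈ (0,1). Let a be a symmetric d×d real matrix and σ a d×d₁ real matrix such that κ I_d + σσᵀ ≤ 2a ≤ κ⁻¹ I_d in the Loewner order. Then for every ξ ∈ ℝ^d and every q ∈ ℝ^{d₁}, one has 2⟨ξ, a ξ⟩ + 2⟨σᵀξ, q⟩ + ‖q‖² ≥ (κ/2)‖ξ‖² + (κ²/4)‖q‖². That is, under the two-sided super-parabolicity condition the quadratic form (ξ,q) ↦ 2⟨ξ, aξ⟩ + 2⟨σᵀξ, q⟩ + ‖q‖² is jointly coercive in (ξ, q) with constants depending only on κ. -/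
open Matrix

/-- Under the two-sided super-parabolicity condition `κ I + σσᵀ ≤ 2a ≤ κ⁻¹ I`
(Loewner order) with `κ ∈ (0,1)`, the quadratic form
`(ξ,q) ↦ 2⟨ξ, aξ⟩ + 2⟨σᵀξ, q⟩ + ‖q‖²` is jointly coercive:
it is bounded below by `(κ/2)‖ξ‖² + (κ²/4)‖q‖²`. -/
theorem superparabolic_joint_coercivity
    (d d₁ : ℕ) (hd : 0 < d) (hd₁ : 0 < d₁) (κ : ℝ) (hκ0 : 0 < κ) (hκ1 : κ < 1)
    (a : Matrix (Fin d) (Fin d) ℝ) (ha : a.IsSymm)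
    (σ : Matrix (Fin d) (Fin d₁) ℝ)
    (hlow : ((2 : ℝ) • a - (κ • (1 : Matrix (Fin d) (Fin d) ℝ) + σ * σᵀ)).PosSemidef)
    (hup : (κ⁻¹ • (1 : Matrix (Fin d) (Fin d) ℝ) - (2 : ℝ) • a).PosSemidef) :
    ∀ (ξ : Fin d → ℝ) (q : Fin d₁ → ℝ),
      (κ / 2) * (ξ ⬝ᵥ ξ) + (κ ^ 2 / 4) * (q ⬝ᵥ q)
        ≤ 2 * (ξ ⬝ᵥ a.mulVec ξ) + 2 * (σᵀ.mulVec ξ ⬝ᵥ q) + q ⬝ᵥ q := by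
  intro ξ q
  have hl := hlow.dotProduct_mulVec_nonneg ξ
  have hu := hup.dotProduct_mulVec_nonneg ξ
  have hS : ξ ⬝ᵥ (σ * σᵀ).mulVec ξ = σᵀ.mulVec ξ ⬝ᵥ σᵀ.mulVec ξ := by
    rw [← Matrix.mulVec_mulVec, Matrix.dotProduct_mulVec, ← Matrix.mulVec_transpose]
  simp only [star_trivial, Matrix.sub_mulVec, Matrix.add_mulVec, Matrix.smul_mulVec,
    Matrix.one_mulVec, dotProduct_sub, dotProduct_add, dotProduct_smul, smul_eq_mul, hS] at hl hu
  set s := σᵀ.mulVec ξ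
  have hP : 0 ≤ (s + q) ⬝ᵥ (s + q) := dotProduct_self_star_nonneg (s + q)
  have hR : 0 ≤ ((2 : ℝ) • s + q) ⬝ᵥ ((2 : ℝ) • s + q) :=
    dotProduct_self_star_nonneg ((2 : ℝ) • s + q)
  have hX : 0 ≤ ξ ⬝ᵥ ξ := dotProduct_self_star_nonneg ξ
  simp only [dotProduct_add, add_dotProduct, dotProduct_smul, smul_dotProduct, smul_eq_mul,
    dotProduct_comm q s] at hP hR
  have hSX : κ * (s ⬝ᵥ s) ≤ ξ ⬝ᵥ ξ := by
    have h : s ⬝ᵥ s ≤ κ⁻¹ * (ξ ⬝ᵥ ξ) := by nlinarith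
    calc κ * (s ⬝ᵥ s) ≤ κ * (κ⁻¹ * (ξ ⬝ᵥ ξ)) := by gcongr
      _ = ξ ⬝ᵥ ξ := mul_inv_cancel_left₀ hκ0.ne' _
  have hκP : κ ^ 2 * (s ⬝ᵥ s + 2 * (s ⬝ᵥ q) + q ⬝ᵥ q)
      ≤ s ⬝ᵥ s + 2 * (s ⬝ᵥ q) + q ⬝ᵥ q :=
    mul_le_of_le_one_left (by linarith) (pow_le_one₀ hκ0.le hκ1.le)
  linarith [mul_nonneg (sq_nonneg κ) hR, mul_le_mul_of_nonneg_left hSX hκ0.le]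
end

section
/- Let d, d₁ be positive integers and κ ∈ (0,1). Let a be a symmetric d×d real matrix, σ a d×d₁ real matrix, and J a d×d real matrix such that κ I_d ≤ J Jᵀ ≤ κ⁻¹ I_d and κ I_d + σσᵀ ≤ 2a ≤ κ⁻¹ I_d (Loewner order). Then the transformed coefficients ã = J a Jᵀ and σ̃ = J σ satisfy the super-parabolicity condition with constant κ², namely κ² I_d + σ̃ σ̃ᵀ ≤ 2 ã ≤ κ⁻² I_d. -/
open Matrix

/-- Transformation of super-parabolic coefficients under a change of coordinates:
if `κ I ≤ J Jᵀ ≤ κ⁻¹ I` and `κ I + σσᵀ ≤ 2a ≤ κ⁻¹ I` (Loewner order), then the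
transformed coefficients `ã = J a Jᵀ` and `σ̃ = J σ` satisfy
`κ² I + σ̃σ̃ᵀ ≤ 2ã ≤ κ⁻² I`. -/
theorem superparabolic_transformed
    (d d₁ : ℕ) (κ : ℝ) (hκ0 : 0 < κ) (hκ1 : κ < 1)
    (a : Matrix (Fin d) (Fin d) ℝ) (ha : a.IsSymm)
    (σ : Matrix (Fin d) (Fin d₁) ℝ) (J : Matrix (Fin d) (Fin d) ℝ)
    (hJlow : (J * Jᵀ - κ • (1 : Matrix (Fin d) (Fin d) ℝ)).PosSemidef)
    (hJup : (κ⁻¹ • (1 : Matrix (Fin d) (Fin d) ℝ) - J * Jᵀ).PosSemidef)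
    (hlow : ((2 : ℝ) • a - (κ • (1 : Matrix (Fin d) (Fin d) ℝ) + σ * σᵀ)).PosSemidef)
    (hup : (κ⁻¹ • (1 : Matrix (Fin d) (Fin d) ℝ) - (2 : ℝ) • a).PosSemidef) :
    ((2 : ℝ) • (J * a * Jᵀ)
        - (κ ^ 2 • (1 : Matrix (Fin d) (Fin d) ℝ) + (J * σ) * (J * σ)ᵀ)).PosSemidef ∧
    ((κ ^ 2)⁻¹ • (1 : Matrix (Fin d) (Fin d) ℝ) - (2 : ℝ) • (J * a * Jᵀ)).PosSemidef := by
  have hl := (hlow.mul_mul_conjTranspose_same J).add (hJlow.smul hκ0.le)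
  have hu := (hup.mul_mul_conjTranspose_same J).add (hJup.smul (inv_nonneg.mpr hκ0.le))
  rw [conjTranspose_eq_transpose_of_trivial] at hl hu
  constructor
  · convert hl using 1
    simp only [Matrix.mul_sub, Matrix.sub_mul, Matrix.mul_add, Matrix.add_mul, Matrix.mul_smul,
      Matrix.smul_mul, Matrix.mul_one, transpose_mul, Matrix.mul_assoc, smul_sub, smul_smul, pow_two]
    abel
  · convert hu using 1
    simp only [Matrix.mul_sub, Matrix.sub_mul, Matrix.mul_smul, Matrix.smul_mul, Matrix.mul_one,
      Matrix.mul_assoc, smul_sub, smul_smul, pow_two, mul_inv]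
    abel
end

section
/- Let 𝒟 be an open subset of ℝ^d with nonempty complement, and for each integer n ≥ 1 let 𝒦_n = {x ∈ ℝ^d : infDist(x, 𝒟ᶜ) ≥ 4·2⁻ⁿ}. Let ζ : ℝ^d → ℝ be a smooth nonnegative function with support in the closed unit ball and ∫ ζ = 1, ζ_n(x) = 2^{nd} ζ(2ⁿ x), and η_n = ζ_n ⋆ 1_{𝒦_n}. Let L ≥ 0 and let ψ : ℝ^d → ℝ be Lipschitz with constant L and vanish on 𝒟ᶜ. Then, with C = 9 L ∫_{ℝ^d} ‖Dζ(y)‖ dy (a constant independent of n and x), one has |ψ(x)| · ‖Dη_n(x)‖ ≤ C for every n ≥ 1 and every x ∈ ℝ^d, where Dη_n denotes the (total) derivative of η_n. -/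
open MeasureTheory

/-- A mollification by `φ` of the indicator of a measurable set has gradient bounded by
`∫ ‖Dφ‖`. -/
theorem norm_fderiv_integral_mul_indicator_le {E : Type*} [NormedAddCommGroup E]
    [NormedSpace ℝ E] [MeasurableSpace E] [BorelSpace E] [FiniteDimensional ℝ E]
    (μ : Measure E) [μ.IsAddHaarMeasure] {φ : E → ℝ} (hφ : ContDiff ℝ 1 φ)
    (hc : HasCompactSupport φ) {K : Set E} (hK : MeasurableSet K) (x : E) :
    ‖fderiv ℝ (fun x => ∫ y, φ (x - y) * K.indicator 1 y ∂μ) x‖ ≤ ∫ y, ‖fderiv ℝ φ y‖ ∂μ := by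
  have hloc : LocallyIntegrable (K.indicator (1 : E → ℝ)) μ :=
    (locallyIntegrable_const (1 : ℝ)).indicator hK
  have hder := hc.hasFDerivAt_convolution_right (ContinuousLinearMap.mul ℝ ℝ) hloc hφ x
  have heq : (fun x => ∫ y, φ (x - y) * K.indicator 1 y ∂μ) =
      convolution (K.indicator (1 : E → ℝ)) φ (ContinuousLinearMap.mul ℝ ℝ) μ := by
    funext z
    simp only [convolution, ContinuousLinearMap.mul_apply']
    simp_rw [mul_comm]
  have hint : Integrable (fun y => ‖fderiv ℝ φ y‖) μ :=
    ((hφ.continuous_fderiv one_ne_zero).integrable_of_hasCompactSupport (hc.fderiv ℝ)).norm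
  rw [heq, hder.fderiv, ← integral_sub_left_eq_self (fun y => ‖fderiv ℝ φ y‖) μ x]
  refine norm_integral_le_of_norm_le (hint.comp_sub_left x) (ae_of_all _ fun y => ?_)
  refine ContinuousLinearMap.opNorm_le_bound _ (norm_nonneg _) fun v => ?_
  rw [ContinuousLinearMap.precompR_apply, ContinuousLinearMap.compL_apply,
    ContinuousLinearMap.comp_apply, ContinuousLinearMap.mul_apply', norm_mul]
  have h1 : ‖K.indicator (1 : E → ℝ) y‖ ≤ 1 := by
    by_cases hy : y ∈ K <;> simp [hy]
  calc _ ≤ 1 * ‖fderiv ℝ φ (x - y) v‖ := by gcongr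
    _ ≤ _ := by rw [one_mul]; exact ContinuousLinearMap.le_opNorm _ _

/-- Away from the boundary of `K` the mollification of its indicator is locally constant: if
`φ` is supported in the ball of radius `r` and `x` is at distance more than `a + r` from `S`,
then the mollified indicator of `{y | a ≤ infDist y S}` has vanishing derivative at `x`. -/
theorem fderiv_integral_mul_indicator_infDist_eq_zero {E : Type*} [NormedAddCommGroup E]
    [NormedSpace ℝ E] [MeasurableSpace E] [BorelSpace E] [FiniteDimensional ℝ E]
    (μ : Measure E) [μ.IsAddHaarMeasure] {φ : E → ℝ} {r a : ℝ}
    (hsupp : Function.support φ ⊆ Metric.closedBall 0 r) {S : Set E} {x : E}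
    (hx : a + r < Metric.infDist x S) :
    fderiv ℝ (fun x => ∫ y, φ (x - y) * {y | a ≤ Metric.infDist y S}.indicator 1 y ∂μ) x = 0 := by
  have hconst : (fun x => ∫ y, φ (x - y) * {y | a ≤ Metric.infDist y S}.indicator 1 y ∂μ)
      =ᶠ[nhds x] fun _ => ∫ y, φ y ∂μ := by
    filter_upwards [(Metric.continuous_infDist_pt S).continuousAt.eventually (lt_mem_nhds hx)]
      with z hz
    rw [← integral_sub_left_eq_self φ μ z]
    refine integral_congr_ae (ae_of_all _ fun y => ?_)
    by_cases hy : φ (z - y) = 0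
    · simp [hy]
    · have h1 : dist z y ≤ r := by
        simpa [dist_eq_norm] using hsupp (Function.mem_support.mpr hy)
      have h2 : Metric.infDist z S ≤ Metric.infDist y S + dist z y :=
        Metric.infDist_le_infDist_add_dist
      have h3 : a ≤ Metric.infDist y S := by linarith
      simp [h3]
  rw [hconst.fderiv_eq]
  simp

/-- The `L¹` norm of the gradient of the rescaled function `c ^ dim E * φ (c • x)` is `c` times
that of `φ`. -/
theorem integral_norm_fderiv_rescale {E : Type*} [NormedAddCommGroup E]
    [NormedSpace ℝ E] [MeasurableSpace E] [BorelSpace E] [FiniteDimensional ℝ E]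
    (μ : Measure E) [μ.IsAddHaarMeasure] {φ : E → ℝ} (hφ : Differentiable ℝ φ) {c : ℝ}
    (hc : 0 < c) :
    ∫ y, ‖fderiv ℝ (fun x => c ^ Module.finrank ℝ E * φ (c • x)) y‖ ∂μ =
      c * ∫ y, ‖fderiv ℝ φ y‖ ∂μ := by
  have hfd (y : E) : ‖fderiv ℝ (fun x => c ^ Module.finrank ℝ E * φ (c • x)) y‖ =
      c ^ Module.finrank ℝ E * c * ‖fderiv ℝ φ (c • y)‖ := by
    have hd : DifferentiableAt ℝ (fun x => φ (c • x)) y := by fun_prop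
    rw [fderiv_const_mul hd, fderiv_comp_smul, norm_smul, norm_smul, Real.norm_of_nonneg hc.le,
      Real.norm_of_nonneg (by positivity), mul_assoc]
  simp_rw [hfd]
  rw [integral_const_mul, Measure.integral_comp_smul μ (fun y => ‖fderiv ℝ φ y‖), smul_eq_mul,
    abs_of_pos (by positivity)]
  field_simp

/-- A function that is `L`-Lipschitz and vanishes on a nonempty closed set `S` is bounded by
`L` times the distance to `S`. -/
theorem abs_le_mul_infDist_of_lipschitz {E : Type*} [PseudoMetricSpace E] [ProperSpace E]
    {S : Set E} (hS : IsClosed S) (hne : S.Nonempty) {L : ℝ} {ψ : E → ℝ}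
    (hlip : ∀ x y, |ψ x - ψ y| ≤ L * dist x y) (hzero : ∀ x ∈ S, ψ x = 0) (x : E) :
    |ψ x| ≤ L * Metric.infDist x S := by
  obtain ⟨z, hz, hzd⟩ := hS.exists_infDist_eq_dist hne x
  simpa [hzero z hz, hzd] using hlip x z

/-- The uniform bound `|ψ(x)| · ‖Dη_n(x)‖ ≤ C` with `C = 9 L ∫ ‖Dζ‖`, for the mollified
cutoffs `η_n = ζ_n ⋆ 1_{𝒦_n}` (where `𝒦_n = {x : dist(x, 𝒟ᶜ) ≥ 4·2⁻ⁿ}`,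
`ζ_n(x) = 2^{nd} ζ(2ⁿ x)`) and an `L`-Lipschitz weight `ψ` vanishing on `𝒟ᶜ`. -/
theorem weight_times_cutoff_gradient_bounded
    (d : ℕ) (𝒟 : Set (EuclideanSpace ℝ (Fin d))) (h𝒟_open : IsOpen 𝒟)
    (h𝒟_ne : 𝒟 ≠ Set.univ)
    (ζ : EuclideanSpace ℝ (Fin d) → ℝ) (hζ_smooth : ContDiff ℝ (⊤ : ℕ∞) ζ)
    (hζ_nonneg : ∀ y, 0 ≤ ζ y)
    (hζ_supp : Function.support ζ ⊆ Metric.closedBall 0 1)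
    (hζ_one : ∫ y, ζ y = 1)
    (L : ℝ) (hL : 0 ≤ L) (ψ : EuclideanSpace ℝ (Fin d) → ℝ)
    (hψ_lip : ∀ x y, |ψ x - ψ y| ≤ L * dist x y)
    (hψ_zero : ∀ x ∉ 𝒟, ψ x = 0) :
    ∀ n : ℕ, 1 ≤ n →
      let ζn : EuclideanSpace ℝ (Fin d) → ℝ :=
        fun x => 2 ^ (n * d) * ζ ((2 ^ n : ℝ) • x)
      let 𝒦 : Set (EuclideanSpace ℝ (Fin d)) :=
        {x | 4 / 2 ^ n ≤ Metric.infDist x 𝒟ᶜ}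
      let η : EuclideanSpace ℝ (Fin d) → ℝ :=
        fun x => ∫ y, ζn (x - y) * Set.indicator 𝒦 1 y
      ∀ x, |ψ x| * ‖fderiv ℝ η x‖ ≤ 9 * L * ∫ y, ‖fderiv ℝ ζ y‖ := by
  intro n _ ζn 𝒦 η x
  have hc : (0 : ℝ) < 2 ^ n := by positivity
  have hζn : ζn = fun x => ((2 : ℝ) ^ n) ^ Module.finrank ℝ (EuclideanSpace ℝ (Fin d)) *
      ζ ((2 ^ n : ℝ) • x) := by
    simp only [ζn, finrank_euclideanSpace_fin, pow_mul]
  have hsupp : Function.support ζn ⊆ Metric.closedBall 0 (1 / 2 ^ n) := by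
    intro y hy
    have h1 : ζ ((2 ^ n : ℝ) • y) ≠ 0 := right_ne_zero_of_mul hy
    have h2 : ‖(2 ^ n : ℝ) • y‖ ≤ 1 := by simpa using hζ_supp h1
    rw [norm_smul, Real.norm_of_nonneg hc.le] at h2
    rw [mem_closedBall_zero_iff, le_div_iff₀ hc]
    linarith
  have hI : 0 ≤ ∫ y, ‖fderiv ℝ ζ y‖ := integral_nonneg fun _ => norm_nonneg _
  by_cases hx : 4 / 2 ^ n + 1 / 2 ^ n < Metric.infDist x 𝒟ᶜ
  · have h0 : fderiv ℝ η x = 0 :=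
      fderiv_integral_mul_indicator_infDist_eq_zero volume hsupp hx
    rw [h0, norm_zero, mul_zero]
    positivity
  · have hζ1 : ContDiff ℝ 1 ζ := hζ_smooth.of_le (by exact_mod_cast le_top)
    have hsmooth : ContDiff ℝ 1 ζn :=
      contDiff_const.mul (hζ1.comp (contDiff_const_smul _))
    have hcompact : HasCompactSupport ζn :=
      HasCompactSupport.of_support_subset_isCompact (isCompact_closedBall _ _) hsupp
    have hmeas : MeasurableSet 𝒦 :=
      (isClosed_le continuous_const (Metric.continuous_infDist_pt _)).measurableSet
    have hgrad : ‖fderiv ℝ η x‖ ≤ 2 ^ n * ∫ y, ‖fderiv ℝ ζ y‖ := by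
      rw [← integral_norm_fderiv_rescale volume (hζ1.differentiable one_ne_zero) hc, ← hζn]
      exact norm_fderiv_integral_mul_indicator_le volume hsmooth hcompact hmeas x
    have hψ : |ψ x| ≤ L * Metric.infDist x 𝒟ᶜ :=
      abs_le_mul_infDist_of_lipschitz h𝒟_open.isClosed_compl
        (Set.nonempty_compl.mpr h𝒟_ne) hψ_lip hψ_zero x
    have hdist : Metric.infDist x 𝒟ᶜ ≤ 9 / 2 ^ n := by
      refine (not_lt.mp hx).trans ?_
      rw [← add_div]
      gcongr
      norm_num
    calc |ψ x| * ‖fderiv ℝ η x‖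
        ≤ (L * (9 / 2 ^ n)) * (2 ^ n * ∫ y, ‖fderiv ℝ ζ y‖) := by
          gcongr
          exact hψ.trans (by gcongr)
      _ = 9 * L * ∫ y, ‖fderiv ℝ ζ y‖ := by field_simp
end
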